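/- For every n ≥ 0 and every q' with 0 ≤ q' ≤ 2^{n+1}, the expected addition count satisfies the recursion E_A(n+1, q') = Σ_{q_L = max(0, q'−2^n)}^{min(q', 2^n)} [C(2^n, q_L)·C(2^n, q'−q_L) / C(2^{n+1}, q')] · ( E_A(n, q_L) + E_A(n, q'−q_L) + 2^{n+1}·(1 − δ(q_L·(q'−q_L))) ), where δ(0) = 1 and δ(x) = 0 for x ≠ 0. (Paper's Lemma 2, additions part.) -/

import Mathlib

/-- The left half (first `2^n` coordinates) of a support pattern of length `2^(n+1)`. -/
def leftHalf (n : ℕ) (z : Fin (2 ^ (n + 1)) → Bool) : Fin (2 ^ n) → Bool :=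
  fun i => z ⟨i.val, by have h := i.isLt; have h2 : 2 ^ (n + 1) = 2 ^ n + 2 ^ n := (by ring); omega⟩

/-- The right half (last `2^n` coordinates) of a support pattern of length `2^(n+1)`. -/
def rightHalf (n : ℕ) (z : Fin (2 ^ (n + 1)) → Bool) : Fin (2 ^ n) → Bool :=
  fun i => z ⟨i.val + 2 ^ n, by have h := i.isLt; have h2 : 2 ^ (n + 1) = 2 ^ n + 2 ^ n := (by ring); omega⟩

/-- Hamming weight of a support pattern: the number of nonzero (true) coordinates. -/
def wt (n : ℕ) (z : Fin (2 ^ n) → Bool) : ℕ :=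
  (Finset.univ.filter fun i => z i = true).card

/-- The number of additions performed by the fast Walsh–Hadamard transform on an
input whose support pattern is `z`:  `A(z) = 0` for length 1, and
`A(z) = A(z_L) + A(z_R) + 2^(n+1)·[z_L ≠ 0 ∧ z_R ≠ 0]` for length `2^(n+1)`. -/
def addCount : (n : ℕ) → (Fin (2 ^ n) → Bool) → ℕ
  | 0, _ => 0
  | n + 1, z =>
      addCount n (leftHalf n z) + addCount n (rightHalf n z) +
        (if (∃ i, leftHalf n z i = true) ∧ (∃ i, rightHalf n z i = true)
          then 2 ^ (n + 1) else 0)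

/-- The number of minus operations performed by the fast Walsh–Hadamard transform
on an input whose support pattern is `z`:  `M(z) = 0` for length 1, and
`M(z) = M(z_L) + M(z_R) + 2^n·[z_R ≠ 0]` for length `2^(n+1)`. -/
def minusCount : (n : ℕ) → (Fin (2 ^ n) → Bool) → ℕ
  | 0, _ => 0
  | n + 1, z =>
      minusCount n (leftHalf n z) + minusCount n (rightHalf n z) +
        (if ∃ i, rightHalf n z i = true then 2 ^ n else 0)

/-- Expected number of additions of the fast WH transform of length `2^n`,
under the uniform distribution on support patterns of Hamming weight `q'`. -/
noncomputable def EA (n q' : ℕ) : ℝ :=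
  (∑ z ∈ Finset.univ.filter fun z : Fin (2 ^ n) → Bool => wt n z = q',
    (addCount n z : ℝ)) / (Nat.choose (2 ^ n) q' : ℝ)

/-- Expected number of minus operations of the fast WH transform of length `2^n`,
under the uniform distribution on support patterns of Hamming weight `q'`. -/
noncomputable def EM (n q' : ℕ) : ℝ :=
  (∑ z ∈ Finset.univ.filter fun z : Fin (2 ^ n) → Bool => wt n z = q',
    (minusCount n z : ℝ)) / (Nat.choose (2 ^ n) q' : ℝ)

theorem two_pow_succ_eq_add (n : ℕ) : 2 ^ (n + 1) = 2 ^ n + 2 ^ n := by ring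

/-- The index `i` of the left half, seen in the full pattern. -/
def leftIndex (n : ℕ) (i : Fin (2 ^ n)) : Fin (2 ^ (n + 1)) :=
  (Fin.castAdd (2 ^ n) i).cast (two_pow_succ_eq_add n).symm

/-- The index `i` of the right half, seen in the full pattern. -/
def rightIndex (n : ℕ) (i : Fin (2 ^ n)) : Fin (2 ^ (n + 1)) :=
  (Fin.natAdd (2 ^ n) i).cast (two_pow_succ_eq_add n).symm

theorem leftHalf_apply (n : ℕ) (z : Fin (2 ^ (n + 1)) → Bool) (i : Fin (2 ^ n)) :
    leftHalf n z i = z (leftIndex n i) := rfl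

theorem rightHalf_apply (n : ℕ) (z : Fin (2 ^ (n + 1)) → Bool) (i : Fin (2 ^ n)) :
    rightHalf n z i = z (rightIndex n i) := by
  unfold rightHalf rightIndex
  congr 1
  ext
  simp

/-- Splitting a support pattern into its two halves is a bijection. -/
def halvesEquiv (n : ℕ) :
    (Fin (2 ^ (n + 1)) → Bool) ≃ (Fin (2 ^ n) → Bool) × (Fin (2 ^ n) → Bool) where
  toFun z := (leftHalf n z, rightHalf n z)
  invFun p := fun i => Fin.append p.1 p.2 (i.cast (two_pow_succ_eq_add n))
  left_inv z := by
    funext i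
    obtain ⟨j, rfl⟩ := (finCongr (two_pow_succ_eq_add n).symm).surjective i
    induction j using Fin.addCases with
    | left j => simp [leftHalf_apply, leftIndex]
    | right j => simp [rightHalf_apply, rightIndex, -Fin.natAdd_eq_addNat]
  right_inv p := by
    ext i <;>
      simp [leftHalf_apply, rightHalf_apply, leftIndex, rightIndex, -Fin.natAdd_eq_addNat]

theorem wt_eq_sum (n : ℕ) (z : Fin (2 ^ n) → Bool) :
    wt n z = ∑ i, (z i).toNat := by
  rw [wt, Finset.card_filter]
  exact Finset.sum_congr rfl fun i _ => by cases z i <;> rfl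

theorem wt_succ (n : ℕ) (z : Fin (2 ^ (n + 1)) → Bool) :
    wt (n + 1) z = wt n (leftHalf n z) + wt n (rightHalf n z) := by
  simp only [wt_eq_sum, leftHalf_apply, rightHalf_apply, leftIndex, rightIndex]
  rw [← Fin.sum_univ_add (fun j : Fin (2 ^ n + 2 ^ n) =>
    (z (j.cast (two_pow_succ_eq_add n).symm)).toNat)]
  exact (Equiv.sum_comp (finCongr (two_pow_succ_eq_add n).symm)
    (fun i => (z i).toNat)).symm

theorem wt_le (n : ℕ) (z : Fin (2 ^ n) → Bool) : wt n z ≤ 2 ^ n :=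
  (Finset.card_filter_le _ _).trans_eq (by simp)

theorem exists_eq_true_iff_wt_ne_zero (n : ℕ) (z : Fin (2 ^ n) → Bool) :
    (∃ i, z i = true) ↔ wt n z ≠ 0 := by
  simp [wt, Finset.filter_eq_empty_iff]

/-- The support patterns of length `2^n` and Hamming weight `q`. -/
def weightClass (n q : ℕ) : Finset (Fin (2 ^ n) → Bool) :=
  Finset.univ.filter fun z => wt n z = q

theorem mem_weightClass {n q : ℕ} {z : Fin (2 ^ n) → Bool} :
    z ∈ weightClass n q ↔ wt n z = q := by
  simp [weightClass]

theorem card_weightClass (n q : ℕ) : (weightClass n q).card = Nat.choose (2 ^ n) q := by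
  have h : (weightClass n q).card =
      (Finset.powersetCard q (Finset.univ : Finset (Fin (2 ^ n)))).card := by
    refine Finset.card_nbij' (fun z => Finset.univ.filter fun i => z i = true)
      (fun s i => decide (i ∈ s)) ?_ ?_ ?_ ?_
    · intro z hz
      exact Finset.mem_powersetCard.2 ⟨Finset.subset_univ _, mem_weightClass.1 hz⟩
    · intro s hs
      refine mem_weightClass.2 ?_
      simpa [wt] using (Finset.mem_powersetCard.1 hs).2
    · intro z _
      simp
    · intro s _
      simp
  simpa using h

theorem sum_addCount_weightClass (n q : ℕ) :
    ∑ z ∈ weightClass n q, (addCount n z : ℝ) = (Nat.choose (2 ^ n) q : ℝ) * EA n q := by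
  by_cases h : (Nat.choose (2 ^ n) q : ℝ) = 0
  · have hempty : weightClass n q = ∅ := by
      rw [← Finset.card_eq_zero, card_weightClass]
      exact_mod_cast h
    simp [hempty, h]
  · exact (mul_div_cancel₀ _ h).symm

/-- A sum over the patterns of weight `q`, grouped by the weight of the left half. -/
theorem sum_weightClass_succ {M : Type*} [AddCommMonoid M] (n q : ℕ)
    (F : (Fin (2 ^ n) → Bool) → (Fin (2 ^ n) → Bool) → M) :
    ∑ z ∈ weightClass (n + 1) q, F (leftHalf n z) (rightHalf n z) =
      ∑ k ∈ Finset.Icc (max 0 (q - 2 ^ n)) (min q (2 ^ n)),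
        ∑ x ∈ weightClass n k, ∑ y ∈ weightClass n (q - k), F x y := by
  rw [← Finset.sum_fiberwise_of_maps_to (g := fun z => wt n (leftHalf n z))]
  · refine Finset.sum_congr rfl fun k hk => ?_
    rw [← Finset.sum_product']
    refine Finset.sum_equiv (halvesEquiv n) (fun z => ?_) fun z _ => rfl
    simp only [Finset.mem_Icc, le_min_iff] at hk
    simp only [Finset.mem_filter, Finset.mem_product, mem_weightClass, wt_succ, halvesEquiv,
      Equiv.coe_fn_mk]
    omega
  · intro z hz
    rw [mem_weightClass, wt_succ] at hz
    have hl := wt_le n (leftHalf n z)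
    have hr := wt_le n (rightHalf n z)
    simp only [Finset.mem_Icc, max_le_iff, le_min_iff]
    omega

theorem addCount_succ_of_wt (n : ℕ) (z : Fin (2 ^ (n + 1)) → Bool) :
    (addCount (n + 1) z : ℝ) =
      addCount n (leftHalf n z) + addCount n (rightHalf n z) +
        (2 : ℝ) ^ (n + 1) *
          (1 - if wt n (leftHalf n z) * wt n (rightHalf n z) = 0 then 1 else 0) := by
  simp only [addCount, exists_eq_true_iff_wt_ne_zero, ← mul_ne_zero_iff]
  by_cases h : wt n (leftHalf n z) * wt n (rightHalf n z) = 0 <;> simp [h]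

/-- **Paper's Lemma 2 (additions part).**  For every `n ≥ 0` and `0 ≤ q' ≤ 2^(n+1)`,
`E_A(n+1, q') = Σ_{q_L = max(0, q'-2^n)}^{min(q', 2^n)}
  [C(2^n,q_L)·C(2^n,q'-q_L)/C(2^(n+1),q')] ·
  (E_A(n,q_L) + E_A(n,q'-q_L) + 2^(n+1)·(1 - δ(q_L·(q'-q_L))))`,
where `δ(0) = 1` and `δ(x) = 0` for `x ≠ 0`. -/
theorem EA_recursion (n q' : ℕ) (hq : q' ≤ 2 ^ (n + 1)) :
    EA (n + 1) q' =
      ∑ qL ∈ Finset.Icc (max 0 (q' - 2 ^ n)) (min q' (2 ^ n)),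
        ((Nat.choose (2 ^ n) qL : ℝ) * (Nat.choose (2 ^ n) (q' - qL) : ℝ) /
            (Nat.choose (2 ^ (n + 1)) q' : ℝ)) *
          (EA n qL + EA n (q' - qL) +
            (2 : ℝ) ^ (n + 1) * (1 - if qL * (q' - qL) = 0 then 1 else 0)) := by
  have hsum : EA (n + 1) q' =
      (∑ z ∈ weightClass (n + 1) q', (addCount (n + 1) z : ℝ)) /
        (Nat.choose (2 ^ (n + 1)) q' : ℝ) := rfl
  simp only [hsum, addCount_succ_of_wt]
  rw [sum_weightClass_succ n q' fun x y => (addCount n x : ℝ) + addCount n y +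
    (2 : ℝ) ^ (n + 1) * (1 - if wt n x * wt n y = 0 then 1 else 0), Finset.sum_div]
  refine Finset.sum_congr rfl fun k _ => ?_
  have hinner : ∀ x ∈ weightClass n k, ∀ y ∈ weightClass n (q' - k),
      (addCount n x : ℝ) + addCount n y +
        (2 : ℝ) ^ (n + 1) * (1 - if wt n x * wt n y = 0 then 1 else 0) =
      (addCount n x : ℝ) + addCount n y +
        (2 : ℝ) ^ (n + 1) * (1 - if k * (q' - k) = 0 then 1 else 0) := by
    intro x hx y hy
    rw [mem_weightClass.1 hx, mem_weightClass.1 hy]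
  rw [Finset.sum_congr rfl fun x hx => Finset.sum_congr rfl (hinner x hx)]
  simp only [Finset.sum_add_distrib, Finset.sum_const, card_weightClass, nsmul_eq_mul,
    ← Finset.mul_sum, sum_addCount_weightClass]
  ring
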